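/- For every integer m ≥ 3, let P_m be the finite simple graph with vertex set {a} ∪ {b_0, …, b_{m−1}} ∪ {c_0, …, c_{2m−1}} and edge set consisting of {a, b_i} for 0 ≤ i ≤ m−1, {c_i, c_{(i+1) mod 2m}} for 0 ≤ i ≤ 2m−1, {b_i, c_{2i}} for 0 ≤ i ≤ m−1, and {b_i, c_{(2i+3) mod 2m}} for 0 ≤ i ≤ m−1. Then P_m has exactly 3m + 1 vertices, the vertex a has degree m, every other vertex of P_m has degree 3, and P_m has girth exactly 5. In particular, for every m ≥ 4, P_m is an ({3,m};5)-graph of order 3m + 1. -/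

import Mathlib

/-- The generalized Petersen-like graph `P_m`: vertex set
`{a} ∪ {b_0, …, b_{m-1}} ∪ {c_0, …, c_{2m-1}}` (encoded as `Unit ⊕ Fin m ⊕ Fin (2*m)`), with
edges `{a, b_i}` for all `i`, the cycle edges `{c_i, c_{(i+1) mod 2m}}`, and the spoke edges
`{b_i, c_{2i}}` and `{b_i, c_{(2i+3) mod 2m}}`. For `m = 3` this is the Petersen graph. -/
def genPetersen (m : ℕ) : SimpleGraph (Unit ⊕ Fin m ⊕ Fin (2 * m)) :=
  SimpleGraph.fromRel fun x y =>
    match x, y with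
    | Sum.inl _, Sum.inr (Sum.inl _) => True
    | Sum.inr (Sum.inl i), Sum.inr (Sum.inr c) =>
        (c : ℕ) = 2 * (i : ℕ) ∨ (c : ℕ) = (2 * (i : ℕ) + 3) % (2 * m)
    | Sum.inr (Sum.inr c), Sum.inr (Sum.inr c') => (c' : ℕ) = ((c : ℕ) + 1) % (2 * m)
    | _, _ => False

section helpers

variable {m : ℕ}

lemma gp_mod1 (hm : 3 ≤ m) (c c' : ℕ) (hc : c < 2 * m) :
    c' = (c + 1) % (2 * m) ↔ (c' = c + 1 ∧ c + 1 < 2 * m) ∨ (c' = 0 ∧ c + 1 = 2 * m) := by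
  rcases Nat.lt_or_ge (c + 1) (2 * m) with h | h
  · rw [Nat.mod_eq_of_lt h]; omega
  · have : c + 1 = 2 * m := by omega
    rw [this, Nat.mod_self]; omega

lemma gp_mod3 (hm : 3 ≤ m) (i c' : ℕ) (hc : i < m) :
    c' = (2 * i + 3) % (2 * m) ↔
      (c' = 2 * i + 3 ∧ 2 * i + 3 < 2 * m) ∨ (c' = 1 ∧ i + 1 = m) := by
  rcases Nat.lt_or_ge (2 * i + 3) (2 * m) with h | h
  · rw [Nat.mod_eq_of_lt h]; omega
  · have : 2 * i + 3 = 1 + 2 * m := by omega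
    rw [this, Nat.add_mod_right, Nat.mod_eq_of_lt (by omega)]; omega

lemma gp_aa (u v : Unit) : ¬ (genPetersen m).Adj (Sum.inl u) (Sum.inl v) := by
  simp [genPetersen]

lemma gp_ab (u : Unit) (i : Fin m) : (genPetersen m).Adj (Sum.inl u) (Sum.inr (Sum.inl i)) := by
  simp [genPetersen]

lemma gp_ac (u : Unit) (c : Fin (2 * m)) :
    ¬ (genPetersen m).Adj (Sum.inl u) (Sum.inr (Sum.inr c)) := by
  simp [genPetersen]

lemma gp_bb (i j : Fin m) :
    ¬ (genPetersen m).Adj (Sum.inr (Sum.inl i)) (Sum.inr (Sum.inl j)) := by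
  simp [genPetersen]

lemma gp_bc (hm : 3 ≤ m) (i : Fin m) (c : Fin (2 * m)) :
    (genPetersen m).Adj (Sum.inr (Sum.inl i)) (Sum.inr (Sum.inr c)) ↔
      (c : ℕ) = 2 * i ∨ ((c : ℕ) = 2 * i + 3) ∨ ((c : ℕ) = 1 ∧ (i : ℕ) + 1 = m) := by
  simp only [genPetersen, SimpleGraph.fromRel_adj, gp_mod3 hm _ _ i.isLt]
  simp
  omega

lemma gp_cc (hm : 3 ≤ m) (c d : Fin (2 * m)) :
    (genPetersen m).Adj (Sum.inr (Sum.inr c)) (Sum.inr (Sum.inr d)) ↔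
      (d : ℕ) = c + 1 ∨ (c : ℕ) = d + 1 ∨ ((d : ℕ) = 0 ∧ (c : ℕ) + 1 = 2 * m) ∨
        ((c : ℕ) = 0 ∧ (d : ℕ) + 1 = 2 * m) := by
  simp only [genPetersen, SimpleGraph.fromRel_adj, gp_mod1 hm _ _ c.isLt, gp_mod1 hm _ _ d.isLt]
  simp [Fin.ext_iff]
  omega

lemma gp_ba (u : Unit) (i : Fin m) : (genPetersen m).Adj (Sum.inr (Sum.inl i)) (Sum.inl u) :=
  (gp_ab u i).symm

lemma gp_ca (u : Unit) (c : Fin (2 * m)) :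
    ¬ (genPetersen m).Adj (Sum.inr (Sum.inr c)) (Sum.inl u) :=
  fun h => gp_ac u c h.symm

lemma gp_cb (hm : 3 ≤ m) (i : Fin m) (c : Fin (2 * m)) :
    (genPetersen m).Adj (Sum.inr (Sum.inr c)) (Sum.inr (Sum.inl i)) ↔
      (c : ℕ) = 2 * i ∨ ((c : ℕ) = 2 * i + 3) ∨ ((c : ℕ) = 1 ∧ (i : ℕ) + 1 = m) := by
  rw [SimpleGraph.adj_comm, gp_bc hm]

lemma gp_no3 (hm : 3 ≤ m) (x y z : Unit ⊕ Fin m ⊕ Fin (2 * m))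
    (h1 : (genPetersen m).Adj x y) (h2 : (genPetersen m).Adj y z)
    (h3 : (genPetersen m).Adj z x) : False := by
  rcases x with x | x | x <;> rcases y with y | y | y <;> rcases z with z | z | z <;>
    simp only [gp_aa, gp_ab, gp_ac, gp_ba, gp_bb, gp_bc hm, gp_ca, gp_cb hm, gp_cc hm] at h1 h2 h3 <;>
    omega

lemma gp_no4 (hm : 3 ≤ m) (x y z w : Unit ⊕ Fin m ⊕ Fin (2 * m))
    (h1 : (genPetersen m).Adj x y) (h2 : (genPetersen m).Adj y z)
    (h3 : (genPetersen m).Adj z w) (h4 : (genPetersen m).Adj w x) (hxz : x ≠ z) (hyw : y ≠ w) :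
    False := by
  rcases x with x | x | x <;> rcases y with y | y | y <;> rcases z with z | z | z <;>
    first
    | (simp only [gp_aa, gp_ac, gp_bb, gp_ca] at h1 h2; done)
    | (rcases w with w | w | w <;>
        simp only [gp_aa, gp_ab, gp_ac, gp_ba, gp_bb, gp_bc hm, gp_ca, gp_cb hm, gp_cc hm]
          at h1 h2 h3 h4 <;>
        simp [Fin.ext_iff] at hxz hyw <;> omega)

lemma gp_deg_a : ((genPetersen m).neighborSet (Sum.inl ())).ncard = m := by
  have : (genPetersen m).neighborSet (Sum.inl ()) =
      Set.range (fun i : Fin m => (Sum.inr (Sum.inl i) : Unit ⊕ Fin m ⊕ Fin (2 * m))) := by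
    ext v
    rcases v with v | v | v <;> simp [gp_aa, gp_ab, gp_ac]
  rw [this, Set.ncard_range_of_injective]
  · simp
  · intro i j h
    simpa using h

lemma gp_deg_b (hm : 3 ≤ m) (i : Fin m) :
    ((genPetersen m).neighborSet (Sum.inr (Sum.inl i))).ncard = 3 := by
  have hi := i.isLt
  obtain ⟨d, hd⟩ : ∃ d : Fin (2 * m), (d : ℕ) = 2 * i + 3 ∨ ((d : ℕ) = 1 ∧ (i : ℕ) + 1 = m) := by
    by_cases h : (i : ℕ) + 1 = m
    · exact ⟨⟨1, by omega⟩, by simp [h]⟩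
    · exact ⟨⟨2 * i + 3, by omega⟩, by simp⟩
  rw [Set.ncard_eq_three]
  refine ⟨Sum.inl (), Sum.inr (Sum.inr ⟨2 * i, by omega⟩), Sum.inr (Sum.inr d), by simp, by simp,
    ?_, ?_⟩
  · simp [Fin.ext_iff]; omega
  · ext v
    rcases v with v | v | v <;> simp [gp_ba, gp_bb, gp_bc hm, Fin.ext_iff]
    omega

lemma gp_deg_c (hm : 3 ≤ m) (c : Fin (2 * m)) :
    ((genPetersen m).neighborSet (Sum.inr (Sum.inr c))).ncard = 3 := by
  have hc := c.isLt
  obtain ⟨p, hp⟩ : ∃ d : Fin (2 * m), (d : ℕ) = c + 1 ∨ ((d : ℕ) = 0 ∧ (c : ℕ) + 1 = 2 * m) := by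
    by_cases h : (c : ℕ) + 1 = 2 * m
    · exact ⟨⟨0, by omega⟩, by simp [h]⟩
    · exact ⟨⟨c + 1, by omega⟩, by simp⟩
  obtain ⟨q, hq⟩ : ∃ d : Fin (2 * m), (c : ℕ) = d + 1 ∨ ((c : ℕ) = 0 ∧ (d : ℕ) + 1 = 2 * m) := by
    by_cases h : (c : ℕ) = 0
    · exact ⟨⟨2 * m - 1, by omega⟩, by simp; omega⟩
    · exact ⟨⟨c - 1, by omega⟩, by simp; omega⟩
  obtain ⟨i, hi⟩ : ∃ i : Fin m, (c : ℕ) = 2 * i ∨ ((c : ℕ) = 2 * i + 3) ∨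
      ((c : ℕ) = 1 ∧ (i : ℕ) + 1 = m) := by
    by_cases h : (c : ℕ) % 2 = 0
    · exact ⟨⟨c / 2, by omega⟩, by simp; omega⟩
    · by_cases h1 : (c : ℕ) = 1
      · exact ⟨⟨m - 1, by omega⟩, by simp; omega⟩
      · exact ⟨⟨(c - 3) / 2, by omega⟩, by simp; omega⟩
  rw [Set.ncard_eq_three]
  refine ⟨Sum.inr (Sum.inl i), Sum.inr (Sum.inr p), Sum.inr (Sum.inr q), by simp, by simp,
    ?_, ?_⟩
  · simp [Fin.ext_iff]; omega
  · ext v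
    rcases v with v | v | v <;> simp [gp_ca, gp_cb hm, gp_cc hm, Fin.ext_iff] <;> omega

lemma gp_girth (hm : 3 ≤ m) : (genPetersen m).egirth = 5 := by
  apply le_antisymm
  · let a : Unit ⊕ Fin m ⊕ Fin (2 * m) := Sum.inl ()
    let b1 : Unit ⊕ Fin m ⊕ Fin (2 * m) := Sum.inr (Sum.inl ⟨1, by omega⟩)
    let c2 : Unit ⊕ Fin m ⊕ Fin (2 * m) := Sum.inr (Sum.inr ⟨2, by omega⟩)
    let c3 : Unit ⊕ Fin m ⊕ Fin (2 * m) := Sum.inr (Sum.inr ⟨3, by omega⟩)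
    let b0 : Unit ⊕ Fin m ⊕ Fin (2 * m) := Sum.inr (Sum.inl ⟨0, by omega⟩)
    have h1 : (genPetersen m).Adj a b1 := gp_ab _ _
    have h2 : (genPetersen m).Adj b1 c2 := (gp_bc hm _ _).2 (by simp)
    have h3 : (genPetersen m).Adj c2 c3 := (gp_cc hm _ _).2 (by simp)
    have h4 : (genPetersen m).Adj c3 b0 := (gp_cb hm _ _).2 (by simp)
    have h5 : (genPetersen m).Adj b0 a := gp_ba _ _
    let w : (genPetersen m).Walk a a := .cons h1 (.cons h2 (.cons h3 (.cons h4 (.cons h5 .nil))))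
    have hw : w.IsCycle :=
      { edges_nodup := by simp [w, a, b1, c2, c3, b0]
        ne_nil := by simp [w]
        support_nodup := by simp [w, a, b1, c2, c3, b0] }
    have := SimpleGraph.egirth_le_length hw
    simpa [w] using this
  · rw [SimpleGraph.le_egirth]
    intro a w hw
    have h5 : 5 ≤ w.length := by
      by_contra hlt
      have h3 := hw.three_le_length
      have hn := hw.support_nodup
      match w, hw, hlt, h3, hn with
      | .nil, _, _, h3, _ => simp at h3
      | .cons _ .nil, _, _, h3, _ => simp at h3
      | .cons _ (.cons _ .nil), _, _, h3, _ => simp at h3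
      | .cons p (.cons q (.cons r .nil)), _, _, _, _ => exact gp_no3 hm _ _ _ p q r
      | .cons p (.cons q (.cons r (.cons s .nil))), _, _, _, hn =>
        simp at hn
        exact gp_no4 hm _ _ _ _ p q r s (by tauto) (by tauto)
      | .cons _ (.cons _ (.cons _ (.cons _ (.cons _ _)))), _, hlt, _, _ =>
        simp at hlt
    exact_mod_cast h5

end helpers

/-- For every `m ≥ 3`, the graph `P_m` has exactly `3m + 1` vertices, the vertex
`a` has degree `m`, every other vertex has degree `3`, and `P_m` has girth exactly `5`. -/
theorem stmt_12 (m : ℕ) (hm : 3 ≤ m) :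
    Nat.card (Unit ⊕ Fin m ⊕ Fin (2 * m)) = 3 * m + 1 ∧
    ((genPetersen m).neighborSet (Sum.inl ())).ncard = m ∧
    (∀ v : Unit ⊕ Fin m ⊕ Fin (2 * m), v ≠ Sum.inl () →
      ((genPetersen m).neighborSet v).ncard = 3) ∧
    (genPetersen m).egirth = 5 := by
  refine ⟨?_, gp_deg_a, ?_, gp_girth hm⟩
  · simp; omega
  · rintro (v | v | v) hv
    · exact absurd rfl hv
    · exact gp_deg_b hm v
    · exact gp_deg_c hm v
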